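/- Let e0, e1 be the standard basis of ℂ², y = (e0 + i·e1)/√2, ȳ = (e0 − i·e1)/√2, R₊ = |y⟩⟨y|, and for δ ∈ ℝ define ζ_δ = (1/√2)(y⊗y + e^{iδ} ȳ⊗ȳ) ∈ ℂ⁴. Then the convex hull (over ℝ) of { |ζ_δ⟩⟨ζ_δ| : δ ∈ ℝ } is exactly the set of 4×4 positive semidefinite complex matrices ρ of trace 1 satisfying trace(ρ · (σy ⊗ σy)) = +1, trace(ρ · (R₊ ⊗ I₂)) = 1/2, and trace(ρ · (I₂ ⊗ R₊)) = 1/2. -/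

import Mathlib

open Matrix Kronecker
open scoped ComplexOrder

noncomputable section

/-- The outer product `|u⟩⟨v|` of two vectors. -/
def outer {ι : Type*} (u v : ι → ℂ) : Matrix ι ι ℂ :=
  Matrix.of fun i j => u i * star (v j)

/-- The tensor (Kronecker) product of two qubit vectors. -/
def tens (u v : Fin 2 → ℂ) : Fin 2 × Fin 2 → ℂ := fun p => u p.1 * v p.2

def e0 : Fin 2 → ℂ := ![1, 0]
def e1 : Fin 2 → ℂ := ![0, 1]

/-- `y = (e0 + i·e1)/√2`. -/
def yp : Fin 2 → ℂ := ((Real.sqrt 2 : ℂ))⁻¹ • (e0 + Complex.I • e1)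
/-- `ȳ = (e0 − i·e1)/√2`. -/
def ym : Fin 2 → ℂ := ((Real.sqrt 2 : ℂ))⁻¹ • (e0 - Complex.I • e1)

/-- The Pauli matrix σy. -/
def sigmaY : Matrix (Fin 2) (Fin 2) ℂ := !![0, -Complex.I; Complex.I, 0]

/-- `ζ_δ = (1/√2)(y⊗y + e^{iδ} ȳ⊗ȳ)`. -/
def zeta (δ : ℝ) : Fin 2 × Fin 2 → ℂ :=
  ((Real.sqrt 2 : ℂ))⁻¹ • (tens yp yp + Complex.exp ((δ : ℂ) * Complex.I) • tens ym ym)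

theorem outer_eq_vecMulVec {ι : Type*} (u v : ι → ℂ) : outer u v = vecMulVec u (star v) := rfl

section Outer

variable {ι : Type*} [Fintype ι]

theorem trace_mul_outer (M : Matrix ι ι ℂ) (u v : ι → ℂ) :
    (M * outer u v).trace = star v ⬝ᵥ M *ᵥ u := by
  rw [outer_eq_vecMulVec, mul_vecMulVec, trace_vecMulVec, dotProduct_comm]

theorem outer_mulVec (u v w : ι → ℂ) : outer u v *ᵥ w = (star v ⬝ᵥ w) • u := by
  rw [outer_eq_vecMulVec, vecMulVec_mulVec]
  ext i
  simp [mul_comm]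

theorem mul_outer (M : Matrix ι ι ℂ) (u v : ι → ℂ) : M * outer u v = outer (M *ᵥ u) v := by
  rw [outer_eq_vecMulVec, mul_vecMulVec, outer_eq_vecMulVec]

theorem posSemidef_outer (u : ι → ℂ) : (outer u u).PosSemidef :=
  posSemidef_vecMulVec_self_star u

theorem star_dotProduct_mulVec_comm {M : Matrix ι ι ℂ} (hM : M.IsHermitian) (x y : ι → ℂ) :
    star (star x ⬝ᵥ M *ᵥ y) = star y ⬝ᵥ M *ᵥ x := by
  rw [star_dotProduct, star_star, star_mulVec, hM.eq, dotProduct_mulVec, dotProduct_comm]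

/-- Two diagonal values `1/2` of a positive semidefinite form bound the off-diagonal one. -/
theorem norm_star_dotProduct_mulVec_le_half {M : Matrix ι ι ℂ} (hM : M.PosSemidef)
    {a b : ι → ℂ} (ha : star a ⬝ᵥ M *ᵥ a = 1 / 2) (hb : star b ⬝ᵥ M *ᵥ b = 1 / 2) :
    ‖star a ⬝ᵥ M *ᵥ b‖ ≤ 1 / 2 := by
  have hba := star_dotProduct_mulVec_comm hM.1 a b
  set z := star a ⬝ᵥ M *ᵥ b
  have h := hM.dotProduct_mulVec_nonneg (b - (2 * z) • a)
  have e : star (b - (2 * z) • a) ⬝ᵥ M *ᵥ (b - (2 * z) • a)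
      = ((1 / 2 - 2 * ‖z‖ ^ 2 : ℝ) : ℂ) := by
    have hz : star z * z = (‖z‖ : ℂ) ^ 2 := by
      simpa using Complex.conj_mul' z
    simp only [star_sub, star_smul, mulVec_sub, mulVec_smul, dotProduct_sub, sub_dotProduct,
      smul_dotProduct, dotProduct_smul, ha, hb, ← hba, smul_eq_mul, star_mul']
    push_cast
    rw [← hz]
    simp only [star_ofNat]
    change _ - 2 * star z * z - _ = _
    ring
  rw [e, Complex.zero_le_real] at h
  nlinarith [norm_nonneg z]

end Outer

theorem inv_sqrt_two_mul_self : ((Real.sqrt 2 : ℂ))⁻¹ * ((Real.sqrt 2 : ℂ))⁻¹ = 1 / 2 := by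
  rw [← mul_inv, ← Complex.ofReal_mul, Real.mul_self_sqrt (by norm_num)]
  norm_num

theorem outer_yp : outer yp yp = !![1 / 2, -Complex.I / 2; Complex.I / 2, 1 / 2] := by
  ext i j
  fin_cases i <;> fin_cases j <;> simp [outer, yp, e0, e1] <;>
    grind [inv_sqrt_two_mul_self, Complex.I_mul_I]

theorem outer_ym : outer ym ym = !![1 / 2, Complex.I / 2; -Complex.I / 2, 1 / 2] := by
  ext i j
  fin_cases i <;> fin_cases j <;> simp [outer, ym, e0, e1] <;>
    grind [inv_sqrt_two_mul_self, Complex.I_mul_I]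

theorem outer_yp_add_outer_ym : outer yp yp + outer ym ym = 1 := by
  rw [outer_yp, outer_ym]
  ext i j
  fin_cases i <;> fin_cases j <;> simp <;> ring

theorem sigmaY_eq : sigmaY = outer yp yp - outer ym ym := by
  rw [outer_yp, outer_ym, sigmaY]
  ext i j
  fin_cases i <;> fin_cases j <;> simp <;> ring

theorem star_yp_dotProduct_yp : star yp ⬝ᵥ yp = 1 := by
  have h := congrArg trace outer_yp
  rw [outer_eq_vecMulVec, trace_vecMulVec, dotProduct_comm] at h
  rw [h]
  simp [trace_fin_two]
  norm_num

theorem star_ym_dotProduct_ym : star ym ⬝ᵥ ym = 1 := by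
  have h := congrArg trace outer_ym
  rw [outer_eq_vecMulVec, trace_vecMulVec, dotProduct_comm] at h
  rw [h]
  simp [trace_fin_two]
  norm_num

theorem star_yp_dotProduct_ym : star yp ⬝ᵥ ym = 0 := by
  simp [dotProduct, Fin.sum_univ_two, yp, ym, e0, e1]
  grind [Complex.I_mul_I]

theorem star_ym_dotProduct_yp : star ym ⬝ᵥ yp = 0 := by
  rw [← star_eq_zero, star_dotProduct, star_star, star_yp_dotProduct_ym]

theorem star_tens_dotProduct_tens (u v u' v' : Fin 2 → ℂ) :
    star (tens u v) ⬝ᵥ tens u' v' = (star u ⬝ᵥ u') * (star v ⬝ᵥ v') := by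
  simp [dotProduct, tens, Fintype.sum_prod_type, Fin.sum_univ_two]
  ring

theorem outer_kronecker_outer (u v : Fin 2 → ℂ) :
    outer u u ⊗ₖ outer v v = outer (tens u v) (tens u v) := by
  ext i j
  simp [outer, tens]
  ring

theorem sum_outer_tens_eq_one :
    outer (tens yp yp) (tens yp yp) + outer (tens yp ym) (tens yp ym)
      + outer (tens ym yp) (tens ym yp) + outer (tens ym ym) (tens ym ym) = 1 := by
  simp only [← outer_kronecker_outer]
  rw [← kronecker_add, add_assoc, ← kronecker_add, ← add_kronecker, outer_yp_add_outer_ym,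
    one_kronecker_one]

theorem sigmaY_kronecker_sigmaY :
    sigmaY ⊗ₖ sigmaY = outer (tens yp yp) (tens yp yp) - outer (tens yp ym) (tens yp ym)
      - outer (tens ym yp) (tens ym yp) + outer (tens ym ym) (tens ym ym) := by
  simp only [← outer_kronecker_outer, sigmaY_eq]
  ext i j
  simp only [kroneckerMap_apply, Matrix.sub_apply, Matrix.add_apply]
  ring

/-- The trace conditions fix the diagonal of `ρ` in the product basis of `σy ⊗ σy`. -/
theorem trace_conditions_iff {ρ : Matrix (Fin 2 × Fin 2) (Fin 2 × Fin 2) ℂ}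
    (hρ : ρ.PosSemidef) :
    (ρ.trace = 1 ∧ (ρ * (sigmaY ⊗ₖ sigmaY)).trace = 1 ∧
      (ρ * (outer yp yp ⊗ₖ (1 : Matrix (Fin 2) (Fin 2) ℂ))).trace = 1/2 ∧
      (ρ * ((1 : Matrix (Fin 2) (Fin 2) ℂ) ⊗ₖ outer yp yp)).trace = 1/2) ↔
    (star (tens yp yp) ⬝ᵥ ρ *ᵥ tens yp yp = 1 / 2 ∧ star (tens ym ym) ⬝ᵥ ρ *ᵥ tens ym ym = 1 / 2 ∧
      star (tens yp ym) ⬝ᵥ ρ *ᵥ tens yp ym = 0 ∧ star (tens ym yp) ⬝ᵥ ρ *ᵥ tens ym yp = 0) := by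
  have hpm := hρ.dotProduct_mulVec_nonneg (tens yp ym)
  have hmp := hρ.dotProduct_mulVec_nonneg (tens ym yp)
  have htr : ρ.trace = (ρ * 1).trace := by rw [mul_one]
  rw [htr, ← sum_outer_tens_eq_one, sigmaY_kronecker_sigmaY, ← outer_yp_add_outer_ym]
  simp only [kronecker_add, add_kronecker, outer_kronecker_outer, mul_add, mul_sub, trace_add,
    trace_sub, trace_mul_outer]
  set p := star (tens yp ym) ⬝ᵥ ρ *ᵥ tens yp ym
  set m := star (tens ym yp) ⬝ᵥ ρ *ᵥ tens ym yp
  constructor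
  · rintro ⟨h1, h2, h3, h4⟩
    have hs : p + m = 0 := by linear_combination (h1 - h2) / 2
    obtain ⟨hp, hm⟩ := (add_eq_zero_iff_of_nonneg hpm hmp).1 hs
    rw [hp, hm] at h1
    rw [hp] at h3
    refine ⟨?_, ?_, hp, hm⟩
    · linear_combination h3
    · linear_combination h1 - h3
  · rintro ⟨h1, h2, h3, h4⟩
    rw [h1, h2, h3, h4]
    norm_num

/-- The operator with diagonal `1/2, 1/2` and off-diagonal entry `c/2` on the span of
`y ⊗ y` and `ȳ ⊗ ȳ`. -/
def coherenceState (c : ℂ) : Matrix (Fin 2 × Fin 2) (Fin 2 × Fin 2) ℂ :=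
  (1 / 2 : ℂ) • (outer (tens yp yp) (tens yp yp) + outer (tens ym ym) (tens ym ym)
    + c • outer (tens ym ym) (tens yp yp) + star c • outer (tens yp yp) (tens ym ym))

theorem outer_zeta (δ : ℝ) :
    outer (zeta δ) (zeta δ) = coherenceState (Complex.exp (δ * Complex.I)) := by
  have hu : Complex.exp (δ * Complex.I) * star (Complex.exp (δ * Complex.I)) = 1 := by
    have := Complex.mul_conj' (Complex.exp (δ * Complex.I))
    simpa [Complex.norm_exp_ofReal_mul_I] using this
  generalize hc : Complex.exp (δ * Complex.I) = c at hu
  have hr : star ((Real.sqrt 2 : ℂ)⁻¹) = (Real.sqrt 2 : ℂ)⁻¹ := by simp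
  ext i j
  simp only [outer, zeta, hc, coherenceState, of_apply, Pi.smul_apply, Pi.add_apply, Matrix.smul_apply,
    Matrix.add_apply, smul_eq_mul, star_mul', star_add, hr]
  linear_combination (tens yp yp i + c * tens ym ym i)
      * (star (tens yp yp j) + star c * star (tens ym ym j)) * inv_sqrt_two_mul_self
    + (1 / 2) * tens ym ym i * star (tens ym ym j) * hu

theorem coherenceState_combo (s t : ℝ) (hst : s + t = 1) (c d : ℂ) :
    coherenceState (s • c + t • d) = s • coherenceState c + t • coherenceState d := by
  have h : (s : ℂ) + t = 1 := by exact_mod_cast hst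
  ext i j
  simp only [coherenceState, Matrix.smul_apply, Matrix.add_apply, smul_eq_mul, Complex.real_smul, star_add,
    star_mul', Complex.star_def, Complex.conj_ofReal]
  linear_combination (-(1 / 2 : ℂ)) * (outer (tens yp yp) (tens yp yp) i j
    + outer (tens ym ym) (tens ym ym) i j) * h

theorem coherenceState_mem_convexHull {c : ℂ} (hc : ‖c‖ ≤ 1) :
    coherenceState c ∈ convexHull ℝ {M | ∃ δ : ℝ, M = outer (zeta δ) (zeta δ)} := by
  set S := convexHull ℝ {M | ∃ δ : ℝ, M = outer (zeta δ) (zeta δ)}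
  have hconv : Convex ℝ (coherenceState ⁻¹' S) := by
    intro x hx y hy s t hs ht hst
    rw [Set.mem_preimage, coherenceState_combo s t hst]
    exact convex_convexHull ℝ _ hx hy hs ht hst
  have hsphere : Metric.sphere (0 : ℂ) 1 ⊆ coherenceState ⁻¹' S := by
    intro x hx
    obtain ⟨θ, rfl⟩ := (Complex.norm_eq_one_iff x).1 (by simpa using hx)
    exact subset_convexHull ℝ _ ⟨θ, (outer_zeta θ).symm⟩
  have hball := convexHull_min hsphere hconv
  rw [convexHull_sphere_eq_closedBall _ zero_le_one] at hball
  exact hball (by simpa using hc)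

theorem eq_coherenceState {ρ : Matrix (Fin 2 × Fin 2) (Fin 2 × Fin 2) ℂ} (hρ : ρ.PosSemidef)
    (hpp : star (tens yp yp) ⬝ᵥ ρ *ᵥ tens yp yp = 1 / 2)
    (hmm : star (tens ym ym) ⬝ᵥ ρ *ᵥ tens ym ym = 1 / 2)
    (hpm : star (tens yp ym) ⬝ᵥ ρ *ᵥ tens yp ym = 0)
    (hmp : star (tens ym yp) ⬝ᵥ ρ *ᵥ tens ym yp = 0) :
    ρ = coherenceState (2 * (star (tens ym ym) ⬝ᵥ ρ *ᵥ tens yp yp)) := by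
  rw [hρ.dotProduct_mulVec_zero_iff] at hpm hmp
  have hker (x k : Fin 2 × Fin 2 → ℂ) (hk : ρ *ᵥ k = 0) : star k ⬝ᵥ ρ *ᵥ x = 0 := by
    rw [← star_dotProduct_mulVec_comm hρ.1, hk, dotProduct_zero, star_zero]
  have hexp (x : Fin 2 × Fin 2 → ℂ) : ρ *ᵥ x =
      (star (tens yp yp) ⬝ᵥ ρ *ᵥ x) • tens yp yp + (star (tens ym ym) ⬝ᵥ ρ *ᵥ x) • tens ym ym := by
    conv_lhs => rw [← one_mulVec (ρ *ᵥ x), ← sum_outer_tens_eq_one]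
    simp only [add_mulVec, outer_mulVec, hker x _ hpm, hker x _ hmp, zero_smul, add_zero]
  have hy := hexp (tens yp yp)
  have hy' := hexp (tens ym ym)
  rw [hpp] at hy
  rw [hmm, ← star_dotProduct_mulVec_comm hρ.1 (tens ym ym) (tens yp yp)] at hy'
  generalize star (tens ym ym) ⬝ᵥ ρ *ᵥ tens yp yp = z at *
  rw [← mul_one ρ, ← sum_outer_tens_eq_one]
  simp only [mul_add, mul_outer, hpm, hmp, hy, hy']
  ext i j
  simp only [coherenceState, outer, of_apply, Pi.smul_apply, Pi.add_apply, Pi.zero_apply,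
    Matrix.smul_apply, Matrix.add_apply, smul_eq_mul, star_mul', star_ofNat]
  ring

theorem convex_trace_conditions :
    Convex ℝ {ρ : Matrix (Fin 2 × Fin 2) (Fin 2 × Fin 2) ℂ |
      ρ.PosSemidef ∧ ρ.trace = 1 ∧
      (ρ * (sigmaY ⊗ₖ sigmaY)).trace = 1 ∧
      (ρ * (outer yp yp ⊗ₖ (1 : Matrix (Fin 2) (Fin 2) ℂ))).trace = 1/2 ∧
      (ρ * ((1 : Matrix (Fin 2) (Fin 2) ℂ) ⊗ₖ outer yp yp)).trace = 1/2} := by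
  rintro x ⟨hx, hx1, hx2, hx3, hx4⟩ y ⟨hy, hy1, hy2, hy3, hy4⟩ s t hs ht hst
  have h : (s : ℂ) + t = 1 := by exact_mod_cast hst
  refine ⟨(hx.smul hs).add (hy.smul ht), ?_, ?_, ?_, ?_⟩ <;>
    simp only [add_mul, smul_mul, trace_add, trace_smul, hx1, hx2, hx3, hx4, hy1, hy2, hy3, hy4,
      Complex.real_smul] <;>
    rw [← add_mul, h, one_mul]

theorem scenario_three_states_characterization :
    convexHull ℝ {M | ∃ δ : ℝ, M = outer (zeta δ) (zeta δ)}
      = {ρ : Matrix (Fin 2 × Fin 2) (Fin 2 × Fin 2) ℂ |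
          ρ.PosSemidef ∧ ρ.trace = 1 ∧
          (ρ * (sigmaY ⊗ₖ sigmaY)).trace = 1 ∧
          (ρ * (outer yp yp ⊗ₖ (1 : Matrix (Fin 2) (Fin 2) ℂ))).trace = 1/2 ∧
          (ρ * ((1 : Matrix (Fin 2) (Fin 2) ℂ) ⊗ₖ outer yp yp)).trace = 1/2} := by
  refine Set.Subset.antisymm (convexHull_min ?_ convex_trace_conditions) ?_
  · rintro _ ⟨δ, rfl⟩
    refine ⟨posSemidef_outer _, (trace_conditions_iff (posSemidef_outer _)).2 ?_⟩
    simp only [outer_zeta, coherenceState, smul_mulVec, add_mulVec, outer_mulVec,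
      dotProduct_smul, dotProduct_add, star_tens_dotProduct_tens, star_yp_dotProduct_yp,
      star_ym_dotProduct_ym, star_yp_dotProduct_ym, star_ym_dotProduct_yp]
    simp
  · rintro ρ ⟨hρ, htr⟩
    obtain ⟨hpp, hmm, hpm, hmp⟩ := (trace_conditions_iff hρ).1 htr
    rw [eq_coherenceState hρ hpp hmm hpm hmp]
    refine coherenceState_mem_convexHull ?_
    have := norm_star_dotProduct_mulVec_le_half hρ hmm hpp
    rw [norm_mul, Complex.norm_ofNat]
    linarith
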